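/- Let P = (x₁,…,xₙ : r₁,…,r_m) be a finite presentation of a group G with unsolvable word problem satisfying condition (2.1) with distinct orders q₁,…,qₚ. Then the predicate on words w in x₁,…,xₙ given by 'the group G_w presented by Q_w is trivial' is not computable. -/

import Mathlib

/-- Generators of the presentation `Q_w`: `Sum.inl i` is the generator `xᵢ`
(for `i : Fin n`), while `Sum.inr 0 = a`, `Sum.inr 1 = α`, `Sum.inr 2 = b`,
`Sum.inr 3 = β`. -/
abbrev QwGen (n : ℕ) := Fin n ⊕ Fin 4

/-- The relators of the presentation `Q_w`: the relators `r₁, …, r_m` (indexed by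
`Sum.inl j`), the relators (iii)/(iv) (indexed by `Sum.inr (Sum.inl i)`, zero-based:
for `i < p` the relator `a^{-qᵢ} xᵢ α^{qᵢ} (β^{-(i+1)} b β^{i+1})⁻¹` and for
`p ≤ i < n` the relator `a^{-(q+i+1)} xᵢ α^{q+i+1} (β^{-(i+1)} b β^{i+1})⁻¹`, where
`q = max {q₁, …, q_p}`), and the relators (i), (ii), (v)
(indexed by `Sum.inr (Sum.inr t)` for `t = 0, 1, 2`). -/
def qwRel (n m p : ℕ) (r : Fin m → FreeGroup (Fin n)) (q : Fin p → ℕ)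
    (w : FreeGroup (Fin n)) : Fin m ⊕ (Fin n ⊕ Fin 3) → FreeGroup (QwGen n) :=
  let a : FreeGroup (QwGen n) := FreeGroup.of (Sum.inr 0)
  let al : FreeGroup (QwGen n) := FreeGroup.of (Sum.inr 1)
  let b : FreeGroup (QwGen n) := FreeGroup.of (Sum.inr 2)
  let be : FreeGroup (QwGen n) := FreeGroup.of (Sum.inr 3)
  let x : Fin n → FreeGroup (QwGen n) := fun i => FreeGroup.of (Sum.inl i)
  let W : FreeGroup (QwGen n) := FreeGroup.map Sum.inl w
  let Q : ℕ := Finset.univ.sup q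
  fun j => match j with
  | Sum.inl j => FreeGroup.map Sum.inl (r j)
  | Sum.inr (Sum.inl i) =>
      if h : (i : ℕ) < p then
        a ^ (-(q ⟨i, h⟩ : ℤ)) * x i * al ^ (q ⟨i, h⟩) *
          (be ^ (-((i : ℕ) + 1 : ℤ)) * b * be ^ ((i : ℕ) + 1))⁻¹
      else
        a ^ (-((Q + (i : ℕ) + 1 : ℕ) : ℤ)) * x i * al ^ (Q + (i : ℕ) + 1) *
          (be ^ (-((i : ℕ) + 1 : ℤ)) * b * be ^ ((i : ℕ) + 1))⁻¹
  | Sum.inr (Sum.inr t) =>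
      if t = 0 then a * al * a⁻¹ * (b ^ 2)⁻¹
      else if t = 1 then al * a * al⁻¹ * (b * be * b⁻¹)⁻¹
      else (W * al ^ 2 * W⁻¹ * (al ^ 2)⁻¹) *
        (be ^ (-((n : ℤ) + 1)) * b * be ^ (n + 1))⁻¹

/-- An action recording the first syllable of a normal form in `ℤ * ℤ * G`. -/
structure SylAct (K G Ω : Type) [Group K] [Group G] [MulAction K Ω] where
  a : K
  b : K
  γ : G →* K
  sa : Ω → ℤ
  sb : Ω → ℤ
  sg : Ω → G
  ha : ∀ (k : ℤ) y, sa (a ^ k • y) = k + sa y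
  hb : ∀ (k : ℤ) y, sb (b ^ k • y) = k + sb y
  hg : ∀ g y, sg (γ g • y) = g * sg y
  dab : ∀ y, sa y = 0 ∨ sb y = 0
  dag : ∀ y, sa y = 0 ∨ sg y = 1
  dbg : ∀ y, sb y = 0 ∨ sg y = 1
  y0 : Ω
  ya : sa y0 = 0
  yb : sb y0 = 0
  yg : sg y0 = 1

/-- Ping-pong in pointwise form. -/
theorem pingpong_pointwise {ι K Ω : Type} [Nontrivial ι] [Group K] [MulAction K Ω] (c : ι → K)
    (X Y : ι → Ω → Prop) (y0 : Ω) (h0 : ∀ i, ¬ Y i y0)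
    (hXX : ∀ i j y, X i y → X j y → i = j) (hYY : ∀ i j y, Y i y → Y j y → i = j)
    (hXY : ∀ i j y, X i y → Y j y → False)
    (h1 : ∀ i y, ¬ Y i y → X i (c i • y)) (h2 : ∀ i y, ¬ X i y → Y i ((c i)⁻¹ • y)) :
    Function.Injective (FreeGroup.lift c) := by
  apply FreeGroup.injective_lift_of_ping_pong c (fun i => {y | X i y}) (fun i => {y | Y i y})
  · intro i
    exact ⟨c i • y0, h1 i y0 (h0 i)⟩
  · intro i j hij
    exact Set.disjoint_left.2 fun y hy hy' => hij (hXX i j y hy hy')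
  · intro i j hij
    exact Set.disjoint_left.2 fun y hy hy' => hij (hYY i j y hy hy')
  · intro i j
    exact Set.disjoint_left.2 fun y hy hy' => hXY i j y hy hy'
  · rintro i _ ⟨y, hy, rfl⟩
    exact h1 i y hy
  · rintro i _ ⟨y, hy, rfl⟩
    exact h2 i y hy

namespace SylAct

variable {K G Ω : Type} [Group K] [Group G] [MulAction K Ω]

/-- The elements on the `b, β` side. -/
def R (S : SylAct K G Ω) (n : ℕ) : Fin n ⊕ Fin 3 → K
  | Sum.inl i => S.b ^ (-((i : ℕ) + 1 : ℤ)) * S.a ^ (1 : ℤ) * S.b ^ ((i : ℕ) + 1 : ℤ)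
  | Sum.inr 0 => S.a ^ (2 : ℤ)
  | Sum.inr 1 => S.a ^ (1 : ℤ) * S.b ^ (1 : ℤ) * S.a ^ (-1 : ℤ)
  | Sum.inr 2 => S.b ^ (-(n + 1 : ℤ)) * S.a ^ (1 : ℤ) * S.b ^ (n + 1 : ℤ)

/-- The elements on the `G, a, α` side. -/
def L (S : SylAct K G Ω) (n : ℕ) (x : Fin n → G) (e : Fin n → ℤ) (w : G) : Fin n ⊕ Fin 3 → K
  | Sum.inl i => S.a ^ (-(e i)) * S.γ (x i) * S.b ^ (e i)
  | Sum.inr 0 => S.a ^ (1 : ℤ) * S.b ^ (1 : ℤ) * S.a ^ (-1 : ℤ)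
  | Sum.inr 1 => S.b ^ (1 : ℤ) * S.a ^ (1 : ℤ) * S.b ^ (-1 : ℤ)
  | Sum.inr 2 => S.γ w * S.b ^ (2 : ℤ) * (S.γ w)⁻¹ * S.b ^ (-2 : ℤ)

def RX (S : SylAct K G Ω) (n : ℕ) : Fin n ⊕ Fin 3 → Ω → Prop
  | Sum.inl i, y => 0 < S.sa (S.b ^ ((i : ℕ) + 1 : ℤ) • y) ∧ S.sb y = -((i : ℕ) + 1 : ℤ)
  | Sum.inr 0, y => 1 < S.sa y
  | Sum.inr 1, y => 0 < S.sb (S.a ^ (-1 : ℤ) • y) ∧ S.sa y = 1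
  | Sum.inr 2, y => 0 < S.sa (S.b ^ (n + 1 : ℤ) • y) ∧ S.sb y = -(n + 1 : ℤ)

def RY (S : SylAct K G Ω) (n : ℕ) : Fin n ⊕ Fin 3 → Ω → Prop
  | Sum.inl i, y => S.sa (S.b ^ ((i : ℕ) + 1 : ℤ) • y) < 0 ∧ S.sb y = -((i : ℕ) + 1 : ℤ)
  | Sum.inr 0, y => S.sa y < 0
  | Sum.inr 1, y => S.sb (S.a ^ (-1 : ℤ) • y) < 0 ∧ S.sa y = 1
  | Sum.inr 2, y => S.sa (S.b ^ (n + 1 : ℤ) • y) < 0 ∧ S.sb y = -(n + 1 : ℤ)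

def LX (S : SylAct K G Ω) (n : ℕ) (e : Fin n → ℤ) (w : G) : Fin n ⊕ Fin 3 → Ω → Prop
  | Sum.inl i, y => S.sa y = -(e i)
  | Sum.inr 0, y => 0 < S.sb (S.a ^ (-1 : ℤ) • y) ∧ S.sa y = 1
  | Sum.inr 1, y => 0 < S.sa (S.b ^ (-1 : ℤ) • y) ∧ S.sb y = 1
  | Sum.inr 2, y => S.sb ((S.γ w)⁻¹ • y) ≠ 0 ∧ S.sg y = w

def LY (S : SylAct K G Ω) (n : ℕ) (e : Fin n → ℤ) (w : G) : Fin n ⊕ Fin 3 → Ω → Prop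
  | Sum.inl i, y => S.sb y = -(e i)
  | Sum.inr 0, y => S.sb (S.a ^ (-1 : ℤ) • y) < 0 ∧ S.sa y = 1
  | Sum.inr 1, y => S.sa (S.b ^ (-1 : ℤ) • y) < 0 ∧ S.sb y = 1
  | Sum.inr 2, y => S.sb ((S.γ w)⁻¹ • (S.b ^ (-2 : ℤ)) • y) ≠ 0 ∧ S.sb y = 2

/-- Conjugate step: `u^{-k} v u^k` moves the complement of one set into the other. -/
theorem conj_b (S : SylAct K G Ω) (k s : ℤ) (hs : s = 1 ∨ s = -1) (y : Ω)
    (h : ¬ (s * S.sa (S.b ^ k • y) < 0 ∧ S.sb y = -k)) :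
    0 < s * S.sa (S.b ^ k • (S.b ^ (-k) * S.a ^ s * S.b ^ k) • y) ∧
      S.sb ((S.b ^ (-k) * S.a ^ s * S.b ^ k) • y) = -k := by
  have e1 : S.b ^ k • (S.b ^ (-k) * S.a ^ s * S.b ^ k) • y = S.a ^ s • S.b ^ k • y := by
    simp only [smul_smul]; congr 1; group
  have e2 : (S.b ^ (-k) * S.a ^ s * S.b ^ k) • y = S.b ^ (-k) • S.a ^ s • S.b ^ k • y := by
    simp only [smul_smul, mul_assoc]
  rw [e1, e2, S.ha, S.hb]
  have h1 := S.hb k y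
  have h2 := S.ha s (S.b ^ k • y)
  have h3 := S.dab (S.a ^ s • S.b ^ k • y)
  have h4 := S.dab (S.b ^ k • y)
  rcases hs with rfl | rfl <;> constructor <;> omega

theorem conj_a (S : SylAct K G Ω) (k s : ℤ) (hs : s = 1 ∨ s = -1) (y : Ω)
    (h : ¬ (s * S.sb (S.a ^ k • y) < 0 ∧ S.sa y = -k)) :
    0 < s * S.sb (S.a ^ k • (S.a ^ (-k) * S.b ^ s * S.a ^ k) • y) ∧
      S.sa ((S.a ^ (-k) * S.b ^ s * S.a ^ k) • y) = -k := by
  have e1 : S.a ^ k • (S.a ^ (-k) * S.b ^ s * S.a ^ k) • y = S.b ^ s • S.a ^ k • y := by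
    simp only [smul_smul]; congr 1; group
  have e2 : (S.a ^ (-k) * S.b ^ s * S.a ^ k) • y = S.a ^ (-k) • S.b ^ s • S.a ^ k • y := by
    simp only [smul_smul, mul_assoc]
  rw [e1, e2, S.hb, S.ha]
  have h1 := S.ha k y
  have h2 := S.hb s (S.a ^ k • y)
  have h3 := S.dab (S.b ^ s • S.a ^ k • y)
  have h4 := S.dab (S.a ^ k • y)
  rcases hs with rfl | rfl <;> constructor <;> omega

theorem b_pos (S : SylAct K G Ω) (k : ℤ) (y : Ω)
    (h : ¬ (S.sa (S.b ^ k • y) < 0 ∧ S.sb y = -k)) :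
    0 < S.sa (S.b ^ k • (S.b ^ (-k) * S.a ^ (1 : ℤ) * S.b ^ k) • y) ∧
      S.sb ((S.b ^ (-k) * S.a ^ (1 : ℤ) * S.b ^ k) • y) = -k := by
  have := S.conj_b k 1 (Or.inl rfl) y (by simpa using h)
  simpa using this

theorem b_neg (S : SylAct K G Ω) (k : ℤ) (y : Ω)
    (h : ¬ (0 < S.sa (S.b ^ k • y) ∧ S.sb y = -k)) :
    S.sa (S.b ^ k • (S.b ^ (-k) * S.a ^ (1 : ℤ) * S.b ^ k)⁻¹ • y) < 0 ∧
      S.sb ((S.b ^ (-k) * S.a ^ (1 : ℤ) * S.b ^ k)⁻¹ • y) = -k := by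
  have := S.conj_b k (-1) (Or.inr rfl) y (by omega)
  have e : (S.b ^ (-k) * S.a ^ (1 : ℤ) * S.b ^ k)⁻¹ = S.b ^ (-k) * S.a ^ (-1 : ℤ) * S.b ^ k := by
    group
  rw [e]; omega

theorem a_pos (S : SylAct K G Ω) (k : ℤ) (y : Ω)
    (h : ¬ (S.sb (S.a ^ k • y) < 0 ∧ S.sa y = -k)) :
    0 < S.sb (S.a ^ k • (S.a ^ (-k) * S.b ^ (1 : ℤ) * S.a ^ k) • y) ∧
      S.sa ((S.a ^ (-k) * S.b ^ (1 : ℤ) * S.a ^ k) • y) = -k := by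
  have := S.conj_a k 1 (Or.inl rfl) y (by simpa using h)
  simpa using this

theorem a_neg (S : SylAct K G Ω) (k : ℤ) (y : Ω)
    (h : ¬ (0 < S.sb (S.a ^ k • y) ∧ S.sa y = -k)) :
    S.sb (S.a ^ k • (S.a ^ (-k) * S.b ^ (1 : ℤ) * S.a ^ k)⁻¹ • y) < 0 ∧
      S.sa ((S.a ^ (-k) * S.b ^ (1 : ℤ) * S.a ^ k)⁻¹ • y) = -k := by
  have := S.conj_a k (-1) (Or.inr rfl) y (by omega)
  have e : (S.a ^ (-k) * S.b ^ (1 : ℤ) * S.a ^ k)⁻¹ = S.a ^ (-k) * S.b ^ (-1 : ℤ) * S.a ^ k := by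
    group
  rw [e]; omega

theorem R_injective (S : SylAct K G Ω) (n : ℕ) : Function.Injective (FreeGroup.lift (S.R n)) := by
  have hd := S.dab
  have : Nontrivial (Fin n ⊕ Fin 3) := ⟨Sum.inr 0, Sum.inr 1, by simp⟩
  apply pingpong_pointwise (S.R n) (S.RX n) (S.RY n) S.y0
  · have := S.ya
    have := S.yb
    rintro (i | i)
    · simp only [RY]; omega
    · fin_cases i <;> simp only [RY] <;> omega
  · rintro (i | i) (j | j) y hi hj <;> have := hd y
    · simp only [RX] at hi hj
      congr 1; ext; omega
    · fin_cases j <;> simp only [RX] at hi hj <;> omega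
    · fin_cases i <;> simp only [RX] at hi hj <;> omega
    · fin_cases i <;> fin_cases j <;>
        first
        | rfl
        | (simp only [RX] at hi hj; omega)
  · rintro (i | i) (j | j) y hi hj <;> have := hd y
    · simp only [RY] at hi hj
      congr 1; ext; omega
    · fin_cases j <;> simp only [RY] at hi hj <;> omega
    · fin_cases i <;> simp only [RY] at hi hj <;> omega
    · fin_cases i <;> fin_cases j <;>
        first
        | rfl
        | (simp only [RY] at hi hj; omega)
  · rintro (i | i) (j | j) y hi hj <;> have := hd y
    · simp only [RX, RY] at hi hj
      have : i = j := by ext; omega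
      subst this; omega
    · fin_cases j <;> simp only [RX, RY] at hi hj <;>
        omega
    · fin_cases i <;> simp only [RX, RY] at hi hj <;>
        omega
    · fin_cases i <;> fin_cases j <;>
        (simp only [RX, RY] at hi hj; omega)
  · rintro (i | i) y hy
    · exact S.b_pos _ y hy
    · fin_cases i
      · have := S.ha 2 y
        simp only [RY, RX, R] at hy ⊢; omega
      · exact S.a_pos (-1) y hy
      · exact S.b_pos _ y hy
  · rintro (i | i) y hy
    · exact S.b_neg _ y hy
    · fin_cases i
      · have := S.ha (-2) y
        rw [zpow_neg] at this
        simp only [RY, RX, R] at hy ⊢; omega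
      · exact S.a_neg (-1) y hy
      · exact S.b_neg _ y hy

theorem L_injective (S : SylAct K G Ω) (n : ℕ) (x : Fin n → G) (e : Fin n → ℤ)
    (he : Function.Injective e) (hpos : ∀ i, 0 < e i) (w : G) (hw : w ≠ 1) :
    Function.Injective (FreeGroup.lift (S.L n x e w)) := by
  have hd := S.dab
  have hd1 := S.dag
  have hd2 := S.dbg
  have hgi : ∀ g y, S.sg ((S.γ g)⁻¹ • y) = g⁻¹ * S.sg y := by
    intro g y; rw [← map_inv, S.hg]
  have : Nontrivial (Fin n ⊕ Fin 3) := ⟨Sum.inr 0, Sum.inr 1, by simp⟩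
  apply pingpong_pointwise (S.L n x e w) (S.LX n e w) (S.LY n e w) S.y0
  · have := S.ya
    have := S.yb
    rintro (i | i)
    · have := hpos i
      simp only [LY]; omega
    · fin_cases i <;> simp only [LY] <;> omega
  · rintro (i | i) (j | j) y hi hj <;> have := hd y <;>
      have h5 : S.sg y = w → S.sa y = 0 ∧ S.sb y = 0 := by
        have := hd1 y; have := hd2 y; grind
    · simp only [LX] at hi hj
      congr 1; apply he; omega
    · have := hpos i
      fin_cases j <;> simp only [LX] at hi hj <;> grind
    · have := hpos j
      fin_cases i <;> simp only [LX] at hi hj <;> grind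
    · fin_cases i <;> fin_cases j <;>
        first
        | rfl
        | (simp only [LX] at hi hj; grind)
  · rintro (i | i) (j | j) y hi hj <;> have := hd y
    · simp only [LY] at hi hj
      congr 1; apply he; omega
    · have := hpos i
      fin_cases j <;> simp only [LY] at hi hj <;> omega
    · have := hpos j
      fin_cases i <;> simp only [LY] at hi hj <;> omega
    · fin_cases i <;> fin_cases j <;>
        first
        | rfl
        | (simp only [LY] at hi hj; omega)
  · rintro (i | i) (j | j) y hi hj <;> have := hd y <;>
      have h5 : S.sg y = w → S.sa y = 0 ∧ S.sb y = 0 := by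
        have := hd1 y; have := hd2 y; grind
    · have := hpos i
      have := hpos j
      simp only [LX, LY] at hi hj; omega
    · have := hpos i
      fin_cases j <;> simp only [LX, LY] at hi hj <;>
        grind
    · have := hpos j
      fin_cases i <;> simp only [LX, LY] at hi hj <;>
        grind
    · fin_cases i <;> fin_cases j <;>
        (simp only [LX, LY] at hi hj; grind)
  · rintro (i | i) y hy
    · simp only [LX, LY, L] at hy ⊢
      have e2 : (S.a ^ (-e i) * S.γ (x i) * S.b ^ e i) • y
          = S.a ^ (-e i) • S.γ (x i) • S.b ^ e i • y := by
        simp only [smul_smul, mul_assoc]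
      rw [e2, S.ha]
      have h1 := S.hb (e i) y
      have h2 := hd (S.b ^ e i • y)
      have h3 := hd2 (S.b ^ e i • y)
      have h4 := S.hg (x i) (S.b ^ e i • y)
      have h5 := hd1 (S.γ (x i) • S.b ^ e i • y)
      by_cases hx : x i = 1
      · rw [hx, map_one, one_smul]; omega
      · have : S.sg (S.b ^ e i • y) = 1 := h3.resolve_left (by omega)
        rw [this, mul_one] at h4
        rw [h4] at h5
        have := h5.resolve_right hx
        omega
    · fin_cases i
      · exact S.a_pos (-1) y hy
      · exact S.b_pos (-1) y hy
      · simp only [LX, LY, L] at hy ⊢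
        have e1 : (S.γ w)⁻¹ • (S.γ w * S.b ^ (2 : ℤ) * (S.γ w)⁻¹ * S.b ^ (-2 : ℤ)) • y
            = S.b ^ (2 : ℤ) • (S.γ w)⁻¹ • S.b ^ (-2 : ℤ) • y := by
          simp only [smul_smul]; congr 1; group
        have e2 : (S.γ w * S.b ^ (2 : ℤ) * (S.γ w)⁻¹ * S.b ^ (-2 : ℤ)) • y
            = S.γ w • S.b ^ (2 : ℤ) • (S.γ w)⁻¹ • S.b ^ (-2 : ℤ) • y := by
          simp only [smul_smul, mul_assoc]
        rw [e1, e2, S.hg]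
        have h1 := S.hb 2 ((S.γ w)⁻¹ • S.b ^ (-2 : ℤ) • y)
        have h2 := S.hb (-2) y
        have h3 := hd2 ((S.γ w)⁻¹ • S.b ^ (-2 : ℤ) • y)
        have h4 := hd2 (S.b ^ (2 : ℤ) • (S.γ w)⁻¹ • S.b ^ (-2 : ℤ) • y)
        have h5 := hgi w (S.b ^ (-2 : ℤ) • y)
        have h6 := hd2 (S.b ^ (-2 : ℤ) • y)
        have key : S.sb ((S.γ w)⁻¹ • S.b ^ (-2 : ℤ) • y) = 0 := by
          by_contra hne
          have h7 := h3.resolve_left hne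
          rw [h7] at h5
          have h8 : S.sg (S.b ^ (-2 : ℤ) • y) ≠ 1 := by
            intro h; rw [h] at h5; simp at h5; exact hw h5
          have := h6.resolve_right h8
          omega
        refine ⟨by omega, ?_⟩
        rw [h4.resolve_left (by omega), mul_one]
  · rintro (i | i) y hy
    · simp only [LX, LY, L] at hy ⊢
      have e2 : (S.a ^ (-e i) * S.γ (x i) * S.b ^ e i)⁻¹ • y
          = S.b ^ (-e i) • S.γ (x i)⁻¹ • S.a ^ e i • y := by
        rw [map_inv]
        simp only [smul_smul]; congr 1; group
      rw [e2, S.hb]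
      have h1 := S.ha (e i) y
      have h2 := hd (S.a ^ e i • y)
      have h3 := hd1 (S.a ^ e i • y)
      have h4 := S.hg (x i)⁻¹ (S.a ^ e i • y)
      have h5 := hd2 (S.γ (x i)⁻¹ • S.a ^ e i • y)
      by_cases hx : (x i)⁻¹ = 1
      · rw [hx, map_one, one_smul]; omega
      · have : S.sg (S.a ^ e i • y) = 1 := h3.resolve_left (by omega)
        rw [this, mul_one] at h4
        rw [h4] at h5
        have := h5.resolve_right hx
        omega
    · fin_cases i
      · exact S.a_neg (-1) y hy
      · exact S.b_neg (-1) y hy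
      · simp only [LX, LY, L] at hy ⊢
        have e1 : (S.γ w)⁻¹ • S.b ^ (-2 : ℤ) •
            (S.γ w * S.b ^ (2 : ℤ) * (S.γ w)⁻¹ * S.b ^ (-2 : ℤ))⁻¹ • y
            = S.b ^ (-2 : ℤ) • (S.γ w)⁻¹ • y := by
          simp only [smul_smul]; congr 1; group
        have e2 : (S.γ w * S.b ^ (2 : ℤ) * (S.γ w)⁻¹ * S.b ^ (-2 : ℤ))⁻¹ • y
            = S.b ^ (2 : ℤ) • S.γ w • S.b ^ (-2 : ℤ) • (S.γ w)⁻¹ • y := by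
          simp only [smul_smul]; congr 1; group
        rw [e1, e2, S.hb, S.hb]
        have h1 := S.hb (-2) ((S.γ w)⁻¹ • y)
        have h3 := hd2 ((S.γ w)⁻¹ • y)
        have h4 := hd2 (S.b ^ (-2 : ℤ) • (S.γ w)⁻¹ • y)
        have h5 := hgi w y
        have h6 := S.hg w (S.b ^ (-2 : ℤ) • (S.γ w)⁻¹ • y)
        have h7 := hd2 (S.γ w • S.b ^ (-2 : ℤ) • (S.γ w)⁻¹ • y)
        have key : S.sb ((S.γ w)⁻¹ • y) = 0 := by
          by_contra hne
          rw [h3.resolve_left hne] at h5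
          exact hy ⟨hne, (inv_mul_eq_one.1 h5.symm).symm⟩
        refine ⟨by omega, ?_⟩
        rw [h4.resolve_left (by omega), mul_one] at h6
        have := h7.resolve_right (by rw [h6]; exact hw)
        omega

end SylAct

open Monoid in
/-- The concrete action, on words in a free product of three copies of `G × ℤ`. -/
theorem exists_sylAct (G : Type) [Group G] :
    ∃ (K Ω : Type) (_ : Group K) (_ : MulAction K Ω), Nonempty (SylAct K G Ω) := by
  classical
  let M : Fin 3 → Type := fun _ => G × Multiplicative ℤ
  let _ : ∀ i, Group (M i) := fun i => inferInstanceAs (Group (G × Multiplicative ℤ))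
  let _ : ∀ i, DecidableEq (M i) := fun i => Classical.decEq _
  let τ : M 0 := ((1, Multiplicative.ofAdd 1) : G × Multiplicative ℤ)
  let τ' : M 1 := ((1, Multiplicative.ofAdd 1) : G × Multiplicative ℤ)
  let γ : G →* CoprodI M := (CoprodI.of (i := 2)).comp (MonoidHom.inl G (Multiplicative ℤ))
  let σ : (i : Fin 3) → CoprodI.Word M → G × Multiplicative ℤ :=
    fun i w => (CoprodI.Word.equivPair i w).head
  have hσ : ∀ (i : Fin 3) (m : M i) (w : CoprodI.Word M),
      σ i (CoprodI.of m • w) = (show G × Multiplicative ℤ from m) * σ i w := by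
    intro i m w
    simp only [σ, CoprodI.Word.equivPair_smul_same]
  have hone : ∀ (i : Fin 3) (w : CoprodI.Word M), w.fstIdx ≠ some i → σ i w = 1 := by
    intro i w h
    simp only [σ, CoprodI.Word.equivPair_eq_of_fstIdx_ne h]
  have hdis : ∀ (i j : Fin 3) (w : CoprodI.Word M), i ≠ j → σ i w = 1 ∨ σ j w = 1 := by
    intro i j w hij
    by_cases h : w.fstIdx = some i
    · right; apply hone; rw [h]; simpa using hij
    · left; exact hone i w h
  refine ⟨CoprodI M, CoprodI.Word M, inferInstance, inferInstance, ⟨{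
    a := CoprodI.of (i := 0) τ
    b := CoprodI.of (i := 1) τ'
    γ := γ
    sa := fun y => Multiplicative.toAdd (σ 0 y).2
    sb := fun y => Multiplicative.toAdd (σ 1 y).2
    sg := fun y => (σ 2 y).1
    ha := ?_, hb := ?_, hg := ?_, dab := ?_, dag := ?_, dbg := ?_
    y0 := CoprodI.Word.empty
    ya := ?_, yb := ?_, yg := ?_ }⟩⟩
  · intro k y
    rw [← map_zpow, hσ]
    have : (show G × Multiplicative ℤ from τ ^ k) = (1, Multiplicative.ofAdd k) := by
      change ((1, Multiplicative.ofAdd 1) : G × Multiplicative ℤ) ^ k = _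
      ext
      · simp
      · simp [← ofAdd_zsmul]
    rw [this]; simp
  · intro k y
    rw [← map_zpow, hσ]
    have : (show G × Multiplicative ℤ from τ' ^ k) = (1, Multiplicative.ofAdd k) := by
      change ((1, Multiplicative.ofAdd 1) : G × Multiplicative ℤ) ^ k = _
      ext
      · simp
      · simp [← ofAdd_zsmul]
    rw [this]; simp
  · intro g y
    change (σ 2 (CoprodI.of (i := 2) _ • y)).1 = _
    rw [hσ]; rfl
  · intro y
    rcases hdis 0 1 y (by decide) with h | h <;> simp [h]
  · intro y
    rcases hdis 0 2 y (by decide) with h | h <;> simp [h]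
  · intro y
    rcases hdis 1 2 y (by decide) with h | h <;> simp [h]
  · rw [hone 0 _ (by simp [CoprodI.Word.fstIdx, CoprodI.Word.empty])]; rfl
  · rw [hone 1 _ (by simp [CoprodI.Word.fstIdx, CoprodI.Word.empty])]; rfl
  · rw [hone 2 _ (by simp [CoprodI.Word.fstIdx, CoprodI.Word.empty])]; rfl

/-- If `w ≠ 1` in `G`, then `G_w` is nontrivial. -/
theorem qw_nontrivial (n m p : ℕ)
    (r : Fin m → FreeGroup (Fin n)) (q : Fin p → ℕ)
    (hq1 : ∀ i, 1 ≤ q i) (hqinj : Function.Injective q) (w : FreeGroup (Fin n))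
    (hw : PresentedGroup.mk (Set.range r) w ≠ 1) :
    ¬ Subsingleton (PresentedGroup (Set.range (qwRel n m p r q w))) := by
  intro hsub
  obtain ⟨K, Ω, _, _, ⟨S⟩⟩ := exists_sylAct (PresentedGroup (Set.range r))
  let x : Fin n → PresentedGroup (Set.range r) := fun i => PresentedGroup.of i
  let e : Fin n → ℤ := fun i => if h : (i : ℕ) < p then (q ⟨i, h⟩ : ℤ)
    else ((Finset.univ.sup q + (i : ℕ) + 1 : ℕ) : ℤ)
  have hsup : ∀ i, q i ≤ Finset.univ.sup q := fun i => Finset.le_sup (Finset.mem_univ i)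
  have he : Function.Injective e := by
    intro i j hij
    simp only [e] at hij
    split_ifs at hij with h1 h2 h2
    · have := hqinj (Nat.cast_injective hij)
      ext; simpa using this
    · have := hsup ⟨i, h1⟩; omega
    · have := hsup ⟨j, h2⟩; omega
    · ext; omega
  have hpos : ∀ i, 0 < e i := by
    intro i
    simp only [e]
    split_ifs with h
    · have := hq1 ⟨i, h⟩; omega
    · omega
  let wG := PresentedGroup.mk (Set.range r) w
  let φ : Bool → (FreeGroup (Fin n ⊕ Fin 3) →* K) := fun t =>
    if t then FreeGroup.lift (S.L n x e wG) else FreeGroup.lift (S.R n)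
  have hφ : ∀ t, Function.Injective (φ t) := by
    intro t
    cases t
    · exact S.R_injective n
    · exact S.L_injective n x e he hpos wG hw
  let P := Monoid.PushoutI (G := fun _ : Bool => K) φ
  let iL : K →* P := Monoid.PushoutI.of (φ := φ) true
  let iR : K →* P := Monoid.PushoutI.of (φ := φ) false
  have hLR : ∀ j, iL (S.L n x e wG j) = iR (S.R n j) := by
    intro j
    have h1 := Monoid.PushoutI.of_apply_eq_base φ true (FreeGroup.of j)
    have h2 := Monoid.PushoutI.of_apply_eq_base φ false (FreeGroup.of j)
    have h3 := h1.trans h2.symm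
    simpa [φ] using h3
  let f : QwGen n → P := Sum.elim (fun i => iL (S.γ (x i))) ![iL S.a, iL S.b, iR S.a, iR S.b]
  have hmap : ∀ u : FreeGroup (Fin n), FreeGroup.lift f (FreeGroup.map Sum.inl u)
      = iL (S.γ (PresentedGroup.mk (Set.range r) u)) := by
    intro u
    have : (FreeGroup.lift f).comp (FreeGroup.map Sum.inl)
        = (iL.comp S.γ).comp (PresentedGroup.mk (Set.range r)) := by
      ext i
      simp [f, x, PresentedGroup.of]
    exact DFunLike.congr_fun this u
  have hc : ∀ (y : P) (k : ℕ), y ^ (k + 1) = y ^ ((k : ℤ) + 1) := by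
    intro y k
    rw [← zpow_natCast]; push_cast; rfl
  have hrel : ∀ s ∈ Set.range (qwRel n m p r q w), FreeGroup.lift f s = 1 := by
    rintro _ ⟨j | i | t, rfl⟩
    · simp only [qwRel, hmap]
      rw [PresentedGroup.one_of_mem (Set.mem_range_self j), map_one, map_one]
    · have := hLR (Sum.inl i)
      simp only [SylAct.L, SylAct.R, e, map_mul, map_zpow] at this
      simp only [qwRel]
      split_ifs at this ⊢ with h
      all_goals
        simp only [map_mul, map_inv, map_zpow, map_pow, FreeGroup.lift_apply_of]
        rw [mul_inv_eq_one]
        refine Eq.trans ?_ (this.trans ?_)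
        · rw [zpow_natCast]; rfl
        · rw [zpow_one, ← hc]; rfl
    · have := hLR (Sum.inr t)
      fin_cases t
      · simp only [SylAct.L, SylAct.R, map_mul, map_zpow] at this
        change FreeGroup.lift f (_ * _) = 1
        simp only [map_mul, map_inv, map_pow, FreeGroup.lift_apply_of]
        rw [mul_inv_eq_one]
        refine Eq.trans ?_ (this.trans ?_)
        · rw [zpow_one, zpow_one, zpow_neg_one]; rfl
        · rw [zpow_ofNat]; rfl
      · simp only [SylAct.L, SylAct.R, map_mul, map_zpow] at this
        change FreeGroup.lift f (_ * _) = 1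
        simp only [map_mul, map_inv, map_pow, FreeGroup.lift_apply_of]
        rw [mul_inv_eq_one]
        refine Eq.trans ?_ (this.trans ?_)
        · rw [zpow_one, zpow_one, zpow_neg_one]; rfl
        · rw [zpow_one, zpow_one, zpow_neg_one]; rfl
      · simp only [SylAct.L, SylAct.R, map_mul, map_zpow, map_inv] at this
        change FreeGroup.lift f (_ * _) = 1
        simp only [map_mul, map_inv, map_pow, map_zpow, FreeGroup.lift_apply_of, hmap]
        rw [mul_inv_eq_one]
        refine Eq.trans ?_ (this.trans ?_)
        · rw [zpow_neg, zpow_ofNat]; rfl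
        · rw [zpow_one, ← hc]; rfl
  have h1 : PresentedGroup.toGroup hrel (PresentedGroup.of (Sum.inr 0)) = 1 := by
    rw [Subsingleton.elim (PresentedGroup.of (Sum.inr 0)) 1, map_one]
  rw [PresentedGroup.toGroup.of] at h1
  have h2 : S.a = 1 := by
    apply Monoid.PushoutI.of_injective hφ true
    rw [map_one]; simpa [f] using h1
  have h3 := S.ha 1 S.y0
  rw [h2, one_zpow, one_smul] at h3
  omega

theorem zpow_neg_succ_aux {A : Type} [Group A] (d : A) (j : ℕ) :
    d ^ (-((j : ℤ) + 1)) = (d ^ (j + 1))⁻¹ := by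
  rw [zpow_neg]; congr 1; exact_mod_cast zpow_natCast d (j + 1)

theorem solve_iii {A : Type} [Group A] (a y al d b : A) (k j : ℕ) (hb : b = 1) (hal : al = 1)
    (h : a ^ (-(k : ℤ)) * y * al ^ k * (d ^ (-((j : ℕ) + 1 : ℤ)) * b * d ^ (j + 1))⁻¹ = 1) :
    y = a ^ k := by
  rw [zpow_neg_succ_aux, hb, hal] at h
  simp only [one_pow, mul_one, inv_mul_cancel, inv_one, zpow_neg, zpow_natCast] at h
  exact (inv_mul_eq_one.1 h).symm

theorem solve_v {A : Type} [Group A] (al d b : A) (n : ℕ)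
    (h : 1 * al ^ 2 * 1⁻¹ * (al ^ 2)⁻¹ * (d ^ (-((n : ℤ) + 1)) * b * d ^ (n + 1))⁻¹ = 1) :
    b = 1 := by
  rw [zpow_neg_succ_aux] at h
  have h2 : (d ^ (n + 1))⁻¹ * b * d ^ (n + 1) = 1 := by
    simp only [one_mul, inv_one, mul_one, mul_inv_cancel] at h
    exact inv_eq_one.1 h
  have h3 := congrArg (fun z => d ^ (n + 1) * z * (d ^ (n + 1))⁻¹) h2
  simpa [mul_assoc] using h3

/-- If `w = 1` in `G`, then `G_w` is trivial. -/
theorem qw_trivial (n m p : ℕ) (hpn : p ≤ n)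
    (r : Fin m → FreeGroup (Fin n)) (q : Fin p → ℕ)
    (horder : ∀ i : Fin p,
      orderOf (Abelianization.of
        (PresentedGroup.of (rels := Set.range r) (Fin.castLE hpn i))) = q i)
    (hgcd : Finset.univ.gcd q = 1) (w : FreeGroup (Fin n))
    (hw : PresentedGroup.mk (Set.range r) w = 1) :
    Subsingleton (PresentedGroup (Set.range (qwRel n m p r q w))) := by
  set GW := PresentedGroup (Set.range (qwRel n m p r q w)) with hGW
  let pr : FreeGroup (QwGen n) →* GW := PresentedGroup.mk _
  have hrel : ∀ j, pr (qwRel n m p r q w j) = 1 := fun j =>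
    PresentedGroup.one_of_mem ⟨j, rfl⟩
  let g : Fin 4 → GW := fun t => pr (FreeGroup.of (Sum.inr t))
  let x : Fin n → GW := fun i => pr (FreeGroup.of (Sum.inl i))
  have hr : ∀ s ∈ Set.range r, FreeGroup.lift x s = 1 := by
    rintro _ ⟨j, rfl⟩
    have := hrel (Sum.inl j)
    simp only [qwRel] at this
    rw [← this, ← MonoidHom.comp_apply]
    congr 1
    ext i; simp [x]
  let ψ : PresentedGroup (Set.range r) →* GW := PresentedGroup.toGroup hr
  have hψ : ∀ u, ψ (PresentedGroup.mk _ u) = pr (FreeGroup.map Sum.inl u) := by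
    intro u
    have : ψ.comp (PresentedGroup.mk _) = pr.comp (FreeGroup.map Sum.inl) := by
      ext i
      change ψ (PresentedGroup.of i) = _
      simp [ψ, x]
    exact DFunLike.congr_fun this u
  have hW : pr (FreeGroup.map Sum.inl w) = 1 := by rw [← hψ, hw, map_one]
  have hb : g 2 = 1 := by
    have := hrel (Sum.inr (Sum.inr 2))
    change pr (_ * _) = 1 at this
    simp only [map_mul, map_inv, map_pow, map_zpow, hW] at this
    change 1 * g 1 ^ 2 * 1⁻¹ * (g 1 ^ 2)⁻¹ *
      (g 3 ^ (-((n : ℤ) + 1)) * g 2 * g 3 ^ (n + 1))⁻¹ = 1 at this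
    exact solve_v _ _ _ _ this
  have hal : g 1 = 1 := by
    have := hrel (Sum.inr (Sum.inr 0))
    change pr (_ * _) = 1 at this
    simp only [map_mul, map_inv, map_pow, map_zpow] at this
    change g 0 * g 1 * (g 0)⁻¹ * (g 2 ^ 2)⁻¹ = 1 at this
    rw [hb] at this
    simpa using this
  have hbe : g 3 = g 0 := by
    have := hrel (Sum.inr (Sum.inr 1))
    change pr (_ * _) = 1 at this
    simp only [map_mul, map_inv, map_pow, map_zpow] at this
    change g 1 * g 0 * (g 1)⁻¹ * (g 2 * g 3 * (g 2)⁻¹)⁻¹ = 1 at this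
    rw [hb, hal] at this
    simp only [inv_one, mul_one, one_mul] at this
    exact (mul_inv_eq_one.1 this).symm
  have hx0 : ∀ i : Fin n, x i = g 0 ^
      (if h : (i : ℕ) < p then q ⟨i, h⟩ else Finset.univ.sup q + (i : ℕ) + 1) := by
    intro i
    have := hrel (Sum.inr (Sum.inl i))
    simp only [qwRel] at this
    split_ifs at this ⊢ with h
    all_goals
      simp only [map_mul, map_inv, map_pow, map_zpow] at this
    · change g 0 ^ (-(q ⟨i, h⟩ : ℤ)) * x i * g 1 ^ (q ⟨i, h⟩) *
          (g 3 ^ (-((i : ℕ) + 1 : ℤ)) * g 2 * g 3 ^ ((i : ℕ) + 1))⁻¹ = 1 at this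
      exact solve_iii _ _ _ _ _ _ _ hb hal this
    · change g 0 ^ (-((Finset.univ.sup q + (i : ℕ) + 1 : ℕ) : ℤ)) * x i *
          g 1 ^ (Finset.univ.sup q + (i : ℕ) + 1) *
          (g 3 ^ (-((i : ℕ) + 1 : ℤ)) * g 2 * g 3 ^ ((i : ℕ) + 1))⁻¹ = 1 at this
      exact solve_iii _ _ _ _ _ _ _ hb hal this
  have hxq : ∀ i : Fin p, x (Fin.castLE hpn i) = g 0 ^ q i := by
    intro i
    rw [hx0]
    simp
  -- every element of `GW` is a power of `g 0`
  have hcyc : ∀ z : GW, z ∈ Subgroup.zpowers (g 0) := by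
    intro z
    apply PresentedGroup.generated_by
    rintro (i | t)
    · change x i ∈ _
      rw [hx0]
      exact Subgroup.npow_mem_zpowers _ _
    · change g t ∈ _
      fin_cases t
      · exact Subgroup.mem_zpowers _
      · change g 1 ∈ _
        rw [hal]; exact one_mem _
      · change g 2 ∈ _
        rw [hb]; exact one_mem _
      · change g 3 ∈ _
        rw [hbe]; exact Subgroup.mem_zpowers _
  have hcomm : ∀ y z : GW, y * z = z * y := by
    intro y z
    obtain ⟨k, rfl⟩ := hcyc y
    obtain ⟨l, rfl⟩ := hcyc z
    exact (Commute.refl (g 0)).zpow_zpow k l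
  let cg : CommGroup GW := { (inferInstance : Group GW) with mul_comm := hcomm }
  have hpow : ∀ i : Fin p, g 0 ^ (q i * q i) = 1 := by
    intro i
    have h1 := pow_orderOf_eq_one (Abelianization.of
        (PresentedGroup.of (rels := Set.range r) (Fin.castLE hpn i)))
    rw [horder] at h1
    have h2 := congrArg (Abelianization.lift (A := GW) ψ) h1
    rw [map_pow, map_one, Abelianization.lift_apply_of] at h2
    have h3 : ψ (PresentedGroup.of (Fin.castLE hpn i)) = x (Fin.castLE hpn i) :=
      PresentedGroup.toGroup.of hr
    rw [h3, hxq, ← pow_mul] at h2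
    exact h2
  have hdvd : ∀ i, orderOf (g 0) ∣ q i * q i := fun i => orderOf_dvd_of_pow_eq_one (hpow i)
  have ho : orderOf (g 0) = 1 := by
    by_contra hne
    obtain ⟨l, hl, hld⟩ := Nat.exists_prime_and_dvd hne
    have h4 : l ∣ Finset.univ.gcd q := Finset.dvd_gcd fun i _ => by
      rcases (Nat.Prime.dvd_mul hl).1 (hld.trans (hdvd i)) with h | h <;> exact h
    rw [hgcd] at h4
    exact hl.one_lt.ne' (Nat.dvd_one.1 h4)
  have hg0 : g 0 = 1 := orderOf_eq_one_iff.1 ho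
  refine ⟨fun y z => ?_⟩
  obtain ⟨k, rfl⟩ := hcyc y
  obtain ⟨l, rfl⟩ := hcyc z
  simp [hg0]

/-- Let `P = (x₁,…,xₙ : r₁,…,r_m)` be a finite presentation of a
group `G` with unsolvable word problem (the predicate `[w] = 1` on words, encoded as
lists of letters, is not computable) satisfying condition (2.1) with distinct orders
`q₁,…,q_p`.  Then the predicate on words `w` given by `the group G_w presented by
Q_w is trivial` is not computable. -/
theorem qw_triviality_undecidable (n m p : ℕ) (hp1 : 1 ≤ p) (hpn : p ≤ n)
    (r : Fin m → FreeGroup (Fin n)) (q : Fin p → ℕ)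
    (hq1 : ∀ i, 1 ≤ q i) (hqinj : Function.Injective q)
    (horder : ∀ i : Fin p,
      orderOf (Abelianization.of
        (PresentedGroup.of (rels := Set.range r) (Fin.castLE hpn i))) = q i)
    (hgcd : Finset.univ.gcd q = 1)
    (hwp : ¬ ComputablePred fun l : List (Fin n × Bool) =>
      PresentedGroup.mk (Set.range r) (FreeGroup.mk l) = 1) :
    ¬ ComputablePred fun l : List (Fin n × Bool) =>
      Subsingleton (PresentedGroup (Set.range (qwRel n m p r q (FreeGroup.mk l)))) := by
  intro h
  apply hwp
  have : (fun l : List (Fin n × Bool) => PresentedGroup.mk (Set.range r) (FreeGroup.mk l) = 1)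
      = fun l => Subsingleton (PresentedGroup (Set.range (qwRel n m p r q (FreeGroup.mk l)))) := by
    funext l
    apply propext
    constructor
    · exact qw_trivial n m p hpn r q horder hgcd _
    · intro hs
      by_contra hne
      exact qw_nontrivial n m p r q hq1 hqinj _ hne hs
  rw [this]
  exact h
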